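/- There is a universal constant C > 0 such that the following holds. Let H ⊆ ℝ^n be a finite set with inference dimension d ≥ 2, and let s be an integer with C·(d + n·log₂ d) ≤ s ≤ |H|. Then at least half of the subsets S ⊆ H of size |S| = s satisfy: for every x ∈ ℝ^n, |infer(S,x) ∩ H| ≥ |H|/8. That is, the number of subsets S of size s for which there exists x ∈ ℝ^n with |infer(S,x) ∩ H| < |H|/8 is at most (1/2)·binomial(|H|, s). -/

import Mathlib

open Finset

namespace LDT

/-- The standard inner product on `ℝ^n`. -/
def ip {n : ℕ} (x h : Fin n → ℝ) : ℝ := ∑ i, x i * h i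

/-- `S` infers `h` at `x`: the sign of `⟨x,h⟩` is determined by the signs of `⟨x,v⟩` for
`v ∈ S ∪ (S - S)`, i.e. every `x'` with the same sign pattern as `x` on `S ∪ (S-S)` gives the
same sign on `h`. -/
def Infers {n : ℕ} (S : Finset (Fin n → ℝ)) (x h : Fin n → ℝ) : Prop :=
  ∀ x' : Fin n → ℝ,
    (∀ v ∈ S, SignType.sign (ip x' v) = SignType.sign (ip x v)) →
    (∀ v ∈ S, ∀ w ∈ S, SignType.sign (ip x' (v - w)) = SignType.sign (ip x (v - w))) →
    SignType.sign (ip x' h) = SignType.sign (ip x h)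

/-- `H` has inference dimension at most `d`: every subset `S ⊆ H` of size at least `d` contains,
for every `x`, an element `h` inferred by `S \ {h}` at `x`. -/
def InfProp {n : ℕ} (H : Finset (Fin n → ℝ)) (d : ℕ) : Prop :=
  ∀ S ⊆ H, d ≤ S.card → ∀ x : Fin n → ℝ, ∃ h ∈ S, Infers (S.erase h) x h

open scoped Classical

section OrderSum

variable {α : Type*} [DecidableEq α]

/-- The sum, over all ways of removing `k` elements one by one from `S`, of `θ` to the number of
removed elements `h` that satisfy `N R h`, where `R` is what is left just after removing `h`. -/
noncomputable def orderSum (N : Finset α → α → Prop) (θ : ℝ) : ℕ → Finset α → ℝ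
  | 0, _ => 1
  | k + 1, S => ∑ h ∈ S, (if N (S.erase h) h then θ else 1) * orderSum N θ k (S.erase h)

lemma orderSum_nonneg (N : Finset α → α → Prop) {θ : ℝ} (hθ : 0 ≤ θ) (k : ℕ) (S : Finset α) :
    0 ≤ orderSum N θ k S := by
  induction k generalizing S with
  | zero => simp [orderSum]
  | succ k ih =>
    refine sum_nonneg fun h _ => mul_nonneg ?_ (ih _)
    split_ifs <;> linarith

lemma factorial_le_orderSum_add (N : Finset α → α → Prop) {θ : ℝ} (hθ : 0 < θ) (k : ℕ)
    (S : Finset α) (hS : S.card = k) {A : ℝ} (hA : 0 < A) :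
    (k.factorial : ℝ) ≤ A * orderSum N θ k S + A⁻¹ * orderSum N θ⁻¹ k S := by
  induction k generalizing S A with
  | zero =>
    simp only [orderSum, Nat.factorial_zero, Nat.cast_one, mul_one]
    rcases le_total 1 A with h | h
    · have := inv_pos.2 hA
      linarith
    · have := (one_le_inv₀ hA).2 h
      linarith
  | succ k ih =>
    have key : ∀ h ∈ S, (k.factorial : ℝ) ≤
        A * ((if N (S.erase h) h then θ else 1) * orderSum N θ k (S.erase h)) +
        A⁻¹ * ((if N (S.erase h) h then θ⁻¹ else 1) * orderSum N θ⁻¹ k (S.erase h)) := by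
      intro h hh
      have hc : (S.erase h).card = k := by rw [card_erase_of_mem hh, hS]; rfl
      split_ifs
      · have := ih _ hc (mul_pos hA hθ)
        rwa [mul_inv, mul_assoc, mul_assoc] at this
      · simpa using ih _ hc hA
    calc ((k + 1).factorial : ℝ) = ∑ h ∈ S, (k.factorial : ℝ) := by
          rw [sum_const, hS, Nat.factorial_succ]; simp
      _ ≤ _ := sum_le_sum key
      _ = _ := by rw [sum_add_distrib, ← mul_sum, ← mul_sum]; rfl

lemma orderSum_le_ascFactorial (N : Finset α → α → Prop) (c d k : ℕ) (S : Finset α)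
    (hS : S.card = k)
    (hN : ∀ T ⊆ S, (T.filter fun h => N (T.erase h) h).card ≤ d) :
    orderSum N (1 + c) k S ≤ ((c * d + 1).ascFactorial k : ℝ) := by
  induction k generalizing S with
  | zero => simp [orderSum]
  | succ k ih =>
    have key : ∀ h ∈ S, (if N (S.erase h) h then (1 + c : ℝ) else 1) *
        orderSum N (1 + c) k (S.erase h) ≤
        (if N (S.erase h) h then (1 + c : ℝ) else 1) * ((c * d + 1).ascFactorial k : ℝ) := by
      intro h hh
      have hc : (S.erase h).card = k := by rw [card_erase_of_mem hh, hS]; rfl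
      refine mul_le_mul_of_nonneg_left
        (ih _ hc fun T hT => hN T (hT.trans (erase_subset _ _))) ?_
      split_ifs <;> positivity
    refine (sum_le_sum key).trans ?_
    rw [← sum_mul, Nat.ascFactorial_succ, Nat.cast_mul]
    refine mul_le_mul_of_nonneg_right ?_ (Nat.cast_nonneg _)
    have e : ∀ h ∈ S, (if N (S.erase h) h then (1 + c : ℝ) else 1) =
        1 + c * (if N (S.erase h) h then (1 : ℝ) else 0) := by
      intro h _
      split_ifs <;> simp
    rw [sum_congr rfl e, sum_add_distrib, ← mul_sum, sum_boole, sum_const, hS]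
    have h1 : ((S.filter fun h => N (S.erase h) h).card : ℝ) ≤ d := by
      exact_mod_cast hN S subset_rfl
    have h2 := mul_le_mul_of_nonneg_left h1 (Nat.cast_nonneg (α := ℝ) c)
    push_cast
    simp only [nsmul_eq_mul, mul_one]
    push_cast
    linarith

lemma sum_powersetCard_succ_le (W : Finset α) (k : ℕ) (P : Finset α → Prop)
    (hP : ∀ S h, P S → P (S.erase h)) (f : Finset α → α → ℝ) (hf : ∀ S h, 0 ≤ f S h) :
    ∑ S ∈ (W.powersetCard (k + 1)).filter P, ∑ h ∈ S, f (S.erase h) h ≤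
      ∑ S ∈ (W.powersetCard k).filter P, ∑ h ∈ W \ S, f S h := by
  rw [sum_sigma', sum_sigma']
  set A := ((W.powersetCard (k + 1)).filter P).sigma fun S => S with hA
  set φ : (Σ _ : Finset α, α) → (Σ _ : Finset α, α) := fun p => ⟨p.1.erase p.2, p.2⟩ with hφ
  have hinj : Set.InjOn φ A := by
    rintro ⟨S, h⟩ hp ⟨S', h'⟩ hp' heq
    simp only [hA, coe_sigma, Set.mem_sigma_iff, mem_coe] at hp hp'
    simp only [hφ, Sigma.mk.injEq, heq_eq_eq] at heq
    obtain ⟨h1, rfl⟩ := heq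
    rw [← insert_erase hp.2, h1, insert_erase hp'.2]
  have hsum : ∑ p ∈ A, f (p.1.erase p.2) p.2 = ∑ p ∈ A.image φ, f p.1 p.2 := by
    rw [sum_image hinj]
  rw [hsum]
  refine sum_le_sum_of_subset_of_nonneg ?_ fun _ _ _ => hf _ _
  intro q hq
  obtain ⟨⟨S, h⟩, hp, rfl⟩ := mem_image.1 hq
  simp only [hA, mem_sigma, mem_filter, mem_powersetCard] at hp
  obtain ⟨⟨⟨hSW, hc⟩, hPS⟩, hh⟩ := hp
  simp only [hφ, mem_sigma, mem_filter, mem_powersetCard, mem_sdiff]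
  refine ⟨⟨⟨(erase_subset _ _).trans hSW, ?_⟩, hP _ _ hPS⟩, hSW hh, by simp⟩
  rw [card_erase_of_mem hh, hc]; rfl

lemma sum_orderSum_le_descFactorial (N : Finset α → α → Prop)
    (hmono : ∀ S T h, S ⊆ T → N T h → N S h) (hself : ∀ S h, N S h → h ∉ S)
    (W : Finset α) {θ ρ u : ℝ} (hθ : 1 ≤ θ) (hρ : 0 ≤ ρ) (hρ1 : ρ ≤ 1)
    (hu : (1 - ρ) * W.card ≤ (1 - θ⁻¹) * u) (k : ℕ) :
    ∑ S ∈ (W.powersetCard k).filter (fun S => u ≤ (W.filter (N S)).card), orderSum N θ⁻¹ k S ≤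
      ρ ^ k * (W.card.descFactorial k : ℝ) := by
  have hθ0 : 0 < θ⁻¹ := inv_pos.2 (by linarith)
  have hθ1 : θ⁻¹ ≤ 1 := inv_le_one_of_one_le₀ hθ
  induction k with
  | zero =>
    simp only [orderSum, sum_const, nsmul_eq_mul, mul_one, pow_zero, Nat.descFactorial_zero,
      Nat.cast_one]
    have := card_filter_le (W.powersetCard 0) (fun S => u ≤ (W.filter (N S)).card)
    rw [card_powersetCard, Nat.choose_zero_right] at this
    exact_mod_cast this
  | succ k ih =>
    have h1 := sum_powersetCard_succ_le W k (fun S => u ≤ (W.filter (N S)).card)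
      (fun S h hS => hS.trans (by
        exact_mod_cast card_le_card (monotone_filter_right W fun g _ hg =>
          hmono _ _ _ (erase_subset h S) hg)))
      (fun S h => (if N S h then θ⁻¹ else 1) * orderSum N θ⁻¹ k S)
      (fun S h => mul_nonneg (by split_ifs <;> linarith) (orderSum_nonneg N hθ0.le _ _))
    refine h1.trans ?_
    have key : ∀ S ∈ (W.powersetCard k).filter (fun S => u ≤ (W.filter (N S)).card),
        ∑ h ∈ W \ S, (if N S h then θ⁻¹ else 1) * orderSum N θ⁻¹ k S ≤
          (ρ * ((W.card - k : ℕ) : ℝ)) * orderSum N θ⁻¹ k S := by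
      intro S hS
      rw [mem_filter, mem_powersetCard] at hS
      obtain ⟨⟨hSW, hc⟩, hU⟩ := hS
      rw [← sum_mul]
      refine mul_le_mul_of_nonneg_right ?_ (orderSum_nonneg N hθ0.le _ _)
      have e : ∀ h ∈ W \ S, (if N S h then θ⁻¹ else 1) =
          1 - (1 - θ⁻¹) * (if N S h then (1 : ℝ) else 0) := by
        intro h _
        split_ifs <;> simp
      have e2 : (W \ S).filter (N S) = W.filter (N S) := by
        ext h
        simp only [mem_filter, mem_sdiff]
        exact ⟨fun h => ⟨h.1.1, h.2⟩, fun h => ⟨⟨h.1, hself _ _ h.2⟩, h.2⟩⟩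
      rw [sum_congr rfl e, sum_sub_distrib, ← mul_sum, sum_boole, sum_const, e2,
        card_sdiff_of_subset hSW, hc, nsmul_eq_mul, mul_one]
      have h2 : (1 - θ⁻¹) * u ≤ (1 - θ⁻¹) * ((W.filter (N S)).card : ℝ) :=
        mul_le_mul_of_nonneg_left hU (by linarith)
      have h3 : ((W.card - k : ℕ) : ℝ) ≤ W.card := by exact_mod_cast Nat.sub_le _ _
      have h4 := mul_le_mul_of_nonneg_left h3 (sub_nonneg.2 hρ1)
      linarith
    refine (sum_le_sum key).trans ?_
    rw [← mul_sum, Nat.descFactorial_succ, Nat.cast_mul, pow_succ]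
    calc _ ≤ ρ * ((W.card - k : ℕ) : ℝ) * (ρ ^ k * (W.card.descFactorial k : ℝ)) :=
          mul_le_mul_of_nonneg_left ih (by positivity)
      _ = _ := by ring

lemma choose_le_pow_mul_pow (a b : ℕ) :
    ((a + b).choose a : ℝ) ≤ (3 / 2) ^ a * 3 ^ b := by
  have h := add_pow (2 / 3 : ℝ) (1 / 3) (a + b)
  have h1 : ((2 / 3 : ℝ)) ^ a * (1 / 3) ^ b * ((a + b).choose a : ℝ) ≤ 1 := by
    have h2 := single_le_sum
      (f := fun m => (2 / 3 : ℝ) ^ m * (1 / 3) ^ (a + b - m) * ((a + b).choose m : ℝ))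
      (fun m _ => by positivity) (mem_range.2 (show a < a + b + 1 by omega))
    rw [← h] at h2
    norm_num at h2 ⊢
    exact h2
  have e : (3 / 2 : ℝ) ^ a * 3 ^ b * ((2 / 3 : ℝ) ^ a * (1 / 3) ^ b) = 1 := by
    rw [mul_mul_mul_comm, ← mul_pow, ← mul_pow]; norm_num
  calc ((a + b).choose a : ℝ)
      = (3 / 2 : ℝ) ^ a * 3 ^ b * ((2 / 3 : ℝ) ^ a * (1 / 3) ^ b * (a + b).choose a) := by
        rw [← mul_assoc, e, one_mul]
    _ ≤ (3 / 2 : ℝ) ^ a * 3 ^ b * 1 := mul_le_mul_of_nonneg_left h1 (by positivity)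
    _ = _ := mul_one _

/-- Among the `s`-subsets `S` of a set `W` of size `8 s`, those for which `N S` holds on a large
part of `W` are exponentially rare. -/
lemma card_filter_powersetCard_le (N : Finset α → α → Prop)
    (hmono : ∀ S T h, S ⊆ T → N T h → N S h) (hself : ∀ S h, N S h → h ∉ S)
    (W : Finset α) (s d : ℕ) (hW : W.card = 8 * s)
    (hN : ∀ T ⊆ W, (T.filter fun h => N (T.erase h) h).card ≤ d) :
    (((W.powersetCard s).filter
      (fun S => 21 / 4 * (s : ℝ) ≤ (W.filter (N S)).card)).card : ℝ) ≤
      2 * 3 ^ (15 * d) * (13 / 16) ^ s * ((8 * s).choose s) := by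
  set ℬ := (W.powersetCard s).filter (fun S => 21 / 4 * (s : ℝ) ≤ (W.filter (N S)).card) with hℬ
  have hF := sum_orderSum_le_descFactorial N hmono hself W (θ := 16) (ρ := 13 / 32)
    (u := 21 / 4 * (s : ℝ)) (by norm_num) (by norm_num) (by norm_num)
    (by rw [hW]; push_cast; nlinarith [Nat.cast_nonneg (α := ℝ) s]) s
  rw [← hℬ, hW, Nat.descFactorial_eq_factorial_mul_choose, Nat.cast_mul] at hF
  have hcard : (ℬ.card : ℝ) ≤ (8 * s).choose s := by
    have := card_filter_le (W.powersetCard s)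
      (fun S => 21 / 4 * (s : ℝ) ≤ (W.filter (N S)).card)
    rw [card_powersetCard, hW] at this
    exact_mod_cast this
  have hB : ∀ S ∈ ℬ, orderSum N 16 s S ≤ s.factorial * ((3 / 2) ^ s * 3 ^ (15 * d)) := by
    intro S hS
    rw [hℬ, mem_filter, mem_powersetCard] at hS
    have h1 := orderSum_le_ascFactorial N 15 d s S hS.1.2 fun T hT => hN T (hT.trans hS.1.1)
    rw [Nat.ascFactorial_eq_factorial_mul_choose, Nat.cast_mul] at h1
    norm_num at h1
    refine h1.trans (mul_le_mul_of_nonneg_left ?_ (by positivity))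
    have := choose_le_pow_mul_pow s (15 * d)
    rwa [add_comm s] at this
  have hs : (0 : ℝ) < s.factorial := by exact_mod_cast Nat.factorial_pos s
  have h2 : (0 : ℝ) < 2 ^ s := by positivity
  have hmain : (ℬ.card : ℝ) * s.factorial ≤
      ((2 : ℝ) ^ s)⁻¹ * ∑ S ∈ ℬ, orderSum N 16 s S +
        2 ^ s * ∑ S ∈ ℬ, orderSum N 16⁻¹ s S := by
    rw [mul_sum, mul_sum, ← sum_add_distrib, ← nsmul_eq_mul, ← sum_const]
    refine sum_le_sum fun S hS => ?_
    rw [hℬ, mem_filter, mem_powersetCard] at hS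
    have := factorial_le_orderSum_add N (θ := 16) (by norm_num) s S hS.1.2 (inv_pos.2 h2)
    rwa [inv_inv] at this
  have hB' : ∑ S ∈ ℬ, orderSum N 16 s S ≤
      (8 * s).choose s * (s.factorial * ((3 / 2) ^ s * 3 ^ (15 * d))) := by
    refine (sum_le_sum hB).trans ?_
    rw [sum_const, nsmul_eq_mul]
    exact mul_le_mul_of_nonneg_right hcard (by positivity)
  have h3 : ((2 : ℝ) ^ s)⁻¹ * (3 / 2) ^ s ≤ (13 / 16) ^ s := by
    rw [← inv_pow, ← mul_pow]
    exact pow_le_pow_left₀ (by norm_num) (by norm_num) _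
  have h4 : (2 : ℝ) ^ s * (13 / 32) ^ s = (13 / 16) ^ s := by
    rw [← mul_pow]; norm_num
  have h5 : (1 : ℝ) ≤ 3 ^ (15 * d) := one_le_pow₀ (by norm_num)
  refine le_of_mul_le_mul_right ?_ hs
  set Q : ℝ := 3 ^ (15 * d)
  set c : ℝ := ((8 * s).choose s : ℝ)
  set F : ℝ := (s.factorial : ℝ)
  have hc : 0 ≤ c := Nat.cast_nonneg _
  calc (ℬ.card : ℝ) * F ≤ ((2 : ℝ) ^ s)⁻¹ * (c * (F * ((3 / 2) ^ s * Q))) +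
        2 ^ s * ((13 / 32) ^ s * (F * c)) := by
        refine hmain.trans (add_le_add ?_ ?_)
        · exact mul_le_mul_of_nonneg_left hB' (by positivity)
        · refine mul_le_mul_of_nonneg_left ?_ (by positivity)
          exact hF
    _ = (((2 : ℝ) ^ s)⁻¹ * (3 / 2) ^ s) * (c * F * Q) + (2 ^ s * (13 / 32) ^ s) * (c * F * 1) := by
        ring
    _ ≤ (13 / 16) ^ s * (c * F * Q) + (13 / 16) ^ s * (c * F * Q) := by
        rw [h4]
        gcongr
    _ = _ := by ring

end OrderSum

lemma sum_choose_le_pow (m r : ℕ) : ∑ k ∈ Iic r, m.choose k ≤ (m + 1) ^ r := by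
  rw [add_pow, Nat.range_succ_eq_Iic]
  refine sum_le_sum fun k hk => ?_
  rw [one_pow, mul_one]
  exact (Nat.choose_le_pow m k).trans
    (Nat.le_mul_of_pos_right _ (Nat.choose_pos (mem_Iic.1 hk)))

lemma sum_mul_ip {n : ℕ} {ι : Type*} (I : Finset ι) (c : ι → ℝ) (v : ι → Fin n → ℝ)
    (x : Fin n → ℝ) : ∑ i ∈ I, c i * ip x (v i) = ip x (∑ i ∈ I, c i • v i) := by
  change _ = dotProduct x _
  rw [dotProduct_sum]
  refine sum_congr rfl fun i _ => ?_
  rw [dotProduct_smul]; rfl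

lemma exists_ip_eq {n : ℕ} (f : (Fin n → ℝ) →ₗ[ℝ] ℝ) : ∃ x, ∀ v, ip x v = f v := by
  refine ⟨fun i => f (Pi.single i 1), fun v => ?_⟩
  rw [LinearMap.pi_apply_eq_sum_univ f v]
  refine sum_congr rfl fun i _ => ?_
  rw [smul_eq_mul, mul_comm]
  refine congrArg (fun w => v i * f w) (funext fun j => ?_)
  simp [Pi.single_apply, eq_comm]

lemma card_le_finrank_of_linearIndependent {n : ℕ} {ι : Type*} [Fintype ι] {v : ι → Fin n → ℝ}
    (hv : LinearIndependent ℝ v) {p : Submodule ℝ (Fin n → ℝ)} (hp : ∀ i, v i ∈ p) :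
    Fintype.card ι ≤ Module.finrank ℝ p := by
  rw [← finrank_span_eq_card hv]
  refine Submodule.finrank_mono (Submodule.span_le.2 ?_)
  rintro _ ⟨i, rfl⟩
  exact hp i

/-- A set all of whose subsets are cut out by open homogeneous half-spaces is linearly
independent. -/
lemma linearIndependent_of_forall_exists_ip_pos {n : ℕ} {ι : Type*} {v : ι → Fin n → ℝ}
    (hv : ∀ t : Set ι, ∃ x, ∀ i, 0 < ip x (v i) ↔ i ∈ t) : LinearIndependent ℝ v := by
  have key : ∀ (I : Finset ι) (c : ι → ℝ), ∑ i ∈ I, c i • v i = 0 → ∀ i ∈ I, c i ≤ 0 := by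
    intro I c hc i hi
    by_contra! hpos
    obtain ⟨x, hx⟩ := hv {j | 0 < c j}
    have h0 := sum_mul_ip I c v x
    rw [hc] at h0
    have h1 : 0 < ∑ i ∈ I, c i * ip x (v i) := by
      refine sum_pos' (fun j _ => ?_) ⟨i, hi, mul_pos hpos ((hx i).2 hpos)⟩
      by_cases hj : 0 < c j
      · exact (mul_pos hj ((hx j).2 hj)).le
      · exact mul_nonneg_of_nonpos_of_nonpos (not_lt.1 hj) (not_lt.1 fun h => hj ((hx j).1 h))
    rw [h0] at h1
    simp [ip] at h1
  rw [linearIndependent_iff']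
  intro I c hc i hi
  refine le_antisymm (key I c hc i hi) ?_
  have := key I (fun j => - c j) (by simp [hc]) i hi
  linarith

/-- A set of vectors spanning a space of dimension at most `r` has few patterns of positivity. -/
lemma exists_pos_representatives {n : ℕ} (V : Finset (Fin n → ℝ))
    {p : Submodule ℝ (Fin n → ℝ)} (hV : ∀ v ∈ V, v ∈ p) :
    ∃ X : Finset (Fin n → ℝ), X.card ≤ (V.card + 1) ^ Module.finrank ℝ p ∧
      ∀ x, ∃ y ∈ X, ∀ v ∈ V, 0 < ip y v ↔ 0 < ip x v := by
  set pat : (Fin n → ℝ) → Finset V := fun x => univ.filter fun v => 0 < ip x v.1 with hpat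
  set 𝒜 : Finset (Finset V) := univ.filter fun A => ∃ x, pat x = A with h𝒜
  have hrep : ∀ A : Finset V, ∃ x, A ∈ 𝒜 → pat x = A := by
    intro A
    by_cases hA : A ∈ 𝒜
    · obtain ⟨x, hx⟩ := (mem_filter.1 hA).2
      exact ⟨x, fun _ => hx⟩
    · exact ⟨0, fun h => absurd h hA⟩
  choose rep hrep using hrep
  refine ⟨𝒜.image rep, ?_, fun x => ?_⟩
  · have hdim : 𝒜.vcDim ≤ Module.finrank ℝ p := by
      refine Finset.sup_le fun s hs => ?_
      rw [mem_shatterer] at hs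
      have hli : LinearIndependent ℝ (fun i : s => (i.1.1 : Fin n → ℝ)) := by
        refine linearIndependent_of_forall_exists_ip_pos fun t => ?_
        obtain ⟨A, hA, hAt⟩ := hs (t := s.filter fun v => ∃ h : v ∈ s, (⟨v, h⟩ : s) ∈ t)
          (filter_subset _ _)
        obtain ⟨x, hx⟩ := (mem_filter.1 hA).2
        refine ⟨x, fun i => ?_⟩
        have h1 := Finset.ext_iff.1 hAt i.1
        rw [mem_inter, mem_filter, ← hx, hpat, mem_filter] at h1
        simpa using h1
      have := card_le_finrank_of_linearIndependent hli (p := p) fun i => hV _ i.1.2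
      rwa [Fintype.card_coe] at this
    calc (𝒜.image rep).card ≤ 𝒜.card := card_image_le
      _ ≤ 𝒜.shatterer.card := card_le_card_shatterer _
      _ ≤ _ := card_shatterer_le_sum_vcDim
      _ ≤ _ := sum_choose_le_pow _ _
      _ ≤ _ := by
        rw [Fintype.card_coe]
        exact Nat.pow_le_pow_right (Nat.succ_pos _) hdim
  · have hx : pat x ∈ 𝒜 := mem_filter.2 ⟨mem_univ _, x, rfl⟩
    refine ⟨rep (pat x), mem_image_of_mem _ hx, fun v hv => ?_⟩
    have := congrArg (fun A => (⟨v, hv⟩ : V) ∈ A) (hrep _ hx)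
    simpa [hpat] using this

lemma ip_neg {n : ℕ} (x v : Fin n → ℝ) : ip x (-v) = - ip x v := dotProduct_neg x v

lemma sign_ip_eq {n : ℕ} {x y v : Fin n → ℝ} (h : 0 < ip y v ↔ 0 < ip x v)
    (h' : 0 < ip y (-v) ↔ 0 < ip x (-v)) : SignType.sign (ip y v) = SignType.sign (ip x v) := by
  rw [ip_neg, ip_neg, neg_pos, neg_pos] at h'
  simp only [sign_apply, h, h']

/-- The sign patterns on `W ∪ (W - W)` are all realized by few points. -/
lemma exists_sign_representatives {n : ℕ} (W : Finset (Fin n → ℝ))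
    {p : Submodule ℝ (Fin n → ℝ)} (hW : ∀ v ∈ W, v ∈ p) :
    ∃ X : Finset (Fin n → ℝ), X.card ≤ (W.card + 1) ^ (2 * Module.finrank ℝ p) ∧
      ∀ x, ∃ y ∈ X, (∀ v ∈ W, SignType.sign (ip y v) = SignType.sign (ip x v)) ∧
        ∀ v ∈ W, ∀ w ∈ W, SignType.sign (ip y (v - w)) = SignType.sign (ip x (v - w)) := by
  set V := W ∪ W.image (fun v => -v) ∪ (W ×ˢ W).image (fun q => q.1 - q.2) with hVdef
  have hV : ∀ v ∈ V, v ∈ p := by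
    intro v hv
    simp only [hVdef, mem_union, mem_image, mem_product] at hv
    rcases hv with (hv | ⟨u, hu, rfl⟩) | ⟨⟨a, b⟩, ⟨ha, hb⟩, rfl⟩
    · exact hW v hv
    · exact p.neg_mem (hW u hu)
    · exact p.sub_mem (hW a ha) (hW b hb)
  obtain ⟨X, hXc, hX⟩ := exists_pos_representatives V hV
  refine ⟨X, hXc.trans ?_, fun x => ?_⟩
  · rw [pow_mul]
    refine Nat.pow_le_pow_left ?_ _
    have h1 : V.card ≤ W.card + W.card + W.card * W.card := by
      refine (card_union_le _ _).trans (add_le_add ((card_union_le _ _).trans ?_) ?_)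
      · exact add_le_add le_rfl card_image_le
      · exact card_image_le.trans (card_product _ _).le
    nlinarith
  · obtain ⟨y, hy, hyx⟩ := hX x
    refine ⟨y, hy, fun v hv => ?_, fun v hv w hw => ?_⟩
    · refine sign_ip_eq (hyx _ ?_) (hyx _ ?_)
      · simp [hVdef, hv]
      · simp only [hVdef, mem_union, mem_image]
        exact Or.inl (Or.inr ⟨v, hv, rfl⟩)
    · refine sign_ip_eq (hyx _ ?_) (hyx _ ?_)
      · simp only [hVdef, mem_union, mem_image, mem_product]
        exact Or.inr ⟨(v, w), ⟨hv, hw⟩, rfl⟩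
      · simp only [hVdef, mem_union, mem_image, mem_product]
        exact Or.inr ⟨(w, v), ⟨hw, hv⟩, by simp⟩

lemma Infers.mono {n : ℕ} {S T : Finset (Fin n → ℝ)} {x h : Fin n → ℝ} (hST : S ⊆ T)
    (hS : Infers S x h) : Infers T x h := fun x' h1 h2 =>
  hS x' (fun v hv => h1 v (hST hv)) fun v hv w hw => h2 v (hST hv) w (hST hw)

lemma infers_of_mem {n : ℕ} {S : Finset (Fin n → ℝ)} {x h : Fin n → ℝ} (hh : h ∈ S) :
    Infers S x h := fun _ h1 _ => h1 h hh

lemma infers_congr {n : ℕ} {S W : Finset (Fin n → ℝ)} {x y h : Fin n → ℝ} (hS : S ⊆ W)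
    (hh : h ∈ W) (h1 : ∀ v ∈ W, SignType.sign (ip y v) = SignType.sign (ip x v))
    (h2 : ∀ v ∈ W, ∀ w ∈ W, SignType.sign (ip y (v - w)) = SignType.sign (ip x (v - w))) :
    Infers S y h ↔ Infers S x h := by
  unfold Infers
  rw [h1 h hh]
  refine forall_congr' fun x' => ?_
  have e1 : (∀ v ∈ S, SignType.sign (ip x' v) = SignType.sign (ip y v)) ↔
      ∀ v ∈ S, SignType.sign (ip x' v) = SignType.sign (ip x v) :=
    forall₂_congr fun v hv => by rw [h1 v (hS hv)]
  have e2 : (∀ v ∈ S, ∀ w ∈ S,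
      SignType.sign (ip x' (v - w)) = SignType.sign (ip y (v - w))) ↔
      ∀ v ∈ S, ∀ w ∈ S, SignType.sign (ip x' (v - w)) = SignType.sign (ip x (v - w)) :=
    forall₂_congr fun v hv => forall₂_congr fun w hw => by rw [h2 v (hS hv) w (hS hw)]
  rw [e1, e2]

/-- Few elements of `T` are not inferred by the others. -/
lemma InfProp.card_filter_not_infers_le {n : ℕ} {H : Finset (Fin n → ℝ)} {d : ℕ}
    (hH : InfProp H d) (x : Fin n → ℝ) {T : Finset (Fin n → ℝ)} (hT : T ⊆ H) :
    (T.filter fun h => ¬ Infers (T.erase h) x h).card ≤ d := by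
  by_contra! hcon
  obtain ⟨h, hh, hinf⟩ := hH (T.filter fun h => ¬ Infers (T.erase h) x h)
    ((filter_subset _ _).trans hT) hcon.le x
  exact (mem_filter.1 hh).2 (hinf.mono (erase_subset_erase _ (filter_subset _ _)))

/-- The inference dimension exceeds the rank. -/
lemma InfProp.finrank_span_le {n : ℕ} {H : Finset (Fin n → ℝ)} {d : ℕ} (hH : InfProp H d) :
    Module.finrank ℝ (Submodule.span ℝ (H : Set (Fin n → ℝ))) ≤ d := by
  by_contra! hcon
  obtain ⟨b, hbH, hspan, hb⟩ := exists_linearIndependent ℝ (H : Set (Fin n → ℝ))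
  have hfin : b.Finite := H.finite_toSet.subset hbH
  lift b to Finset (Fin n → ℝ) using hfin
  have hcard : b.card = Module.finrank ℝ (Submodule.span ℝ (H : Set (Fin n → ℝ))) := by
    rw [← hspan]
    exact (finrank_span_finset_eq_card hb).symm
  obtain ⟨h, hh, hinf⟩ := hH b (by exact_mod_cast hbH) (by omega) 0
  have hnot : h ∉ Submodule.span ℝ ((b.erase h : Finset (Fin n → ℝ)) : Set (Fin n → ℝ)) := by
    have := LinearIndepOn.notMem_span (R := ℝ) (v := id) (s := (b : Set (Fin n → ℝ))) hb hh
    simpa [coe_erase] using this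
  obtain ⟨f, hf, hker⟩ := Submodule.exists_le_ker_of_notMem hnot
  obtain ⟨x', hx'⟩ := exists_ip_eq f
  have h0 : ∀ v ∈ b.erase h, f v = 0 := fun v hv => hker (Submodule.subset_span hv)
  have hz : ∀ v : Fin n → ℝ, ip 0 v = 0 := fun v => by simp [ip]
  have := hinf x' (fun v hv => by rw [hx', h0 v hv, hz])
    fun v hv w hw => by rw [hx', map_sub, h0 v hv, h0 w hw, hz, sub_zero]
  rw [hz, sign_zero, sign_eq_zero_iff, hx'] at this
  exact hf this

section Sampling

variable {α : Type*} [DecidableEq α]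

/-- A Markov bound: most `k`-subsets of `R` meet a set of density at most `1 / 8` in at most a
quarter of their elements. -/
lemma choose_le_two_mul_card_filter (R G : Finset α) (hG : G ⊆ R) (hGR : 8 * G.card ≤ R.card)
    (k : ℕ) (hk : 0 < k) :
    R.card.choose k ≤ 2 * ((R.powersetCard k).filter fun K => 4 * (K ∩ G).card ≤ k).card := by
  have hsum : ∑ K ∈ R.powersetCard k, (K ∩ G).card =
      G.card * (R.card - 1).choose (k - 1) := by
    have h1 : ∀ K ∈ R.powersetCard k, (K ∩ G).card = ∑ g ∈ G, if g ∈ K then 1 else 0 := by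
      intro K _
      rw [← sum_filter, sum_const, smul_eq_mul, mul_one, inter_comm, filter_mem_eq_inter]
    rw [sum_congr rfl h1, sum_comm, card_eq_sum_ones, sum_mul]
    refine sum_congr rfl fun g hg => ?_
    have h2 := card_filter_powersetCard_subset {g} R k (singleton_subset_iff.2 (hG hg))
      (by rwa [card_singleton])
    simp only [singleton_subset_iff, card_singleton] at h2
    rw [← sum_filter, ← card_eq_sum_ones, h2, one_mul]
  have hid : G.card * (R.card - 1).choose (k - 1) * 8 ≤ R.card.choose k * k := by
    rcases Nat.eq_zero_or_pos R.card with h0 | hpos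
    · have : G.card = 0 := by omega
      simp [this]
    · obtain ⟨m, hm⟩ := Nat.exists_eq_add_of_lt hpos
      obtain ⟨l, rfl⟩ := Nat.exists_eq_add_of_lt hk
      rw [hm] at hGR ⊢
      simp only [zero_add, Nat.add_sub_cancel] at hGR ⊢
      rw [← Nat.add_one_mul_choose_eq]
      nlinarith [Nat.zero_le (m.choose l)]
  have hsplit := card_filter_add_card_filter_not (s := R.powersetCard k)
    (fun K => 4 * (K ∩ G).card ≤ k)
  rw [card_powersetCard] at hsplit
  set B := (R.powersetCard k).filter fun K => ¬ 4 * (K ∩ G).card ≤ k with hB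
  have hmark : B.card * k ≤ 4 * ∑ K ∈ R.powersetCard k, (K ∩ G).card := by
    rw [mul_sum, ← smul_eq_mul, ← sum_const]
    refine (sum_le_sum fun K hK => ?_).trans
      (sum_le_sum_of_subset (filter_subset (fun K => ¬ 4 * (K ∩ G).card ≤ k) _))
    exact (not_le.1 (mem_filter.1 hK).2).le
  have : 2 * B.card ≤ R.card.choose k := by
    refine Nat.le_of_mul_le_mul_right ?_ hk
    rw [hsum] at hmark
    linarith
  omega

/-- The ghost sample argument: to count the bad `s`-sets it suffices to count, inside each
`8 s`-set `W`, the `s`-sets that are witnessed to be bad by `W`. -/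
lemma card_filter_powersetCard_le_of_ghost (H : Finset α) (s : ℕ) (hs : 8 * s ≤ H.card)
    (P : Finset α → Prop) (Q : Finset α → Finset α → Prop) (b : ℝ)
    (hP : ∀ S ∈ H.powersetCard s, P S → (H.card - s).choose (7 * s) ≤
      2 * (((H \ S).powersetCard (7 * s)).filter fun K => Q (S ∪ K) S).card)
    (hQ : ∀ W ∈ H.powersetCard (8 * s),
      (((W.powersetCard s).filter (Q W)).card : ℝ) ≤ b * (8 * s).choose s) :
    (((H.powersetCard s).filter P).card : ℝ) ≤ 2 * b * H.card.choose s := by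
  have hinj : ∑ S ∈ (H.powersetCard s).filter P,
      (((H \ S).powersetCard (7 * s)).filter fun K => Q (S ∪ K) S).card ≤
      ∑ W ∈ H.powersetCard (8 * s), ((W.powersetCard s).filter (Q W)).card := by
    rw [← card_sigma, ← card_sigma]
    refine card_le_card_of_injOn (fun p => ⟨p.1 ∪ p.2, p.1⟩) ?_ ?_
    · rintro ⟨S, K⟩ hp
      simp only [coe_sigma, Set.mem_sigma_iff, mem_coe, mem_filter, mem_powersetCard,
        subset_sdiff] at hp ⊢
      obtain ⟨⟨⟨hS, hSc⟩, -⟩, ⟨⟨hK, hd⟩, hKc⟩, hq⟩ := hp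
      refine ⟨⟨union_subset hS hK, ?_⟩, ⟨subset_union_left, hSc⟩, hq⟩
      rw [card_union_of_disjoint hd.symm, hSc, hKc]
      ring
    · rintro ⟨S, K⟩ hp ⟨S', K'⟩ hp' heq
      simp only [coe_sigma, Set.mem_sigma_iff, mem_coe, mem_filter, mem_powersetCard,
        subset_sdiff] at hp hp'
      simp only [Sigma.mk.injEq, heq_eq_eq] at heq
      obtain ⟨h1, rfl⟩ := heq
      have h2 : K = K' := by
        rw [← union_sdiff_cancel_left hp.2.1.1.2.symm, h1,
          union_sdiff_cancel_left hp'.2.1.1.2.symm]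
      rw [h2]
  set c : ℝ := ((H.card - s).choose (7 * s) : ℝ) with hc
  have hcpos : 0 < c := by
    rw [hc]
    exact_mod_cast Nat.choose_pos (by omega)
  have hlow : (((H.powersetCard s).filter P).card : ℝ) * c ≤
      2 * ((∑ S ∈ (H.powersetCard s).filter P,
      (((H \ S).powersetCard (7 * s)).filter fun K => Q (S ∪ K) S).card : ℕ) : ℝ) := by
    rw [Nat.cast_sum, mul_sum, ← nsmul_eq_mul, ← sum_const]
    refine sum_le_sum fun S hS => ?_
    have := hP S (mem_filter.1 hS).1 (mem_filter.1 hS).2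
    rw [hc]
    exact_mod_cast this
  have hup : ((∑ W ∈ H.powersetCard (8 * s), ((W.powersetCard s).filter (Q W)).card : ℕ) : ℝ) ≤
      H.card.choose (8 * s) * (b * (8 * s).choose s) := by
    rw [Nat.cast_sum, ← card_powersetCard, ← nsmul_eq_mul, ← sum_const]
    exact sum_le_sum hQ
  have hch : (H.card.choose (8 * s) : ℝ) * (8 * s).choose s = H.card.choose s * c := by
    have := Nat.choose_mul (n := H.card) (show s ≤ 8 * s by omega)
    rw [show 8 * s - s = 7 * s by omega] at this
    rw [hc]
    exact_mod_cast this
  refine le_of_mul_le_mul_right ?_ hcpos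
  calc _ ≤ _ := hlow
    _ ≤ 2 * (H.card.choose (8 * s) * (b * (8 * s).choose s)) := by
      refine mul_le_mul_of_nonneg_left (le_trans ?_ hup) two_pos.le
      exact_mod_cast hinj
    _ = 2 * b * (H.card.choose (8 * s) * (8 * s).choose s) := by ring
    _ = _ := by rw [hch]; ring

end Sampling

lemma eight_mul_pow_mul_pow_le_one {n d r s : ℕ} (hd : 2 ≤ d) (hrn : r ≤ n) (hrd : r ≤ d)
    (hs : 400 * (d + n * Real.logb 2 d) ≤ (s : ℝ)) :
    8 * (3 ^ (15 * d) * (13 / 16 : ℝ) ^ s * (8 * s + 1) ^ (2 * r)) ≤ 1 := by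
  have hd' : (2 : ℝ) ≤ d := by exact_mod_cast hd
  have hd0 : (0 : ℝ) < d := by linarith
  have hlogd : 0 ≤ Real.log d := Real.log_nonneg (by linarith)
  have hrn' : (r : ℝ) ≤ n := by exact_mod_cast hrn
  have hrd' : (r : ℝ) ≤ d := by exact_mod_cast hrd
  have hr0 : (0 : ℝ) ≤ r := Nat.cast_nonneg r
  have hlogb : Real.log d ≤ Real.logb 2 d := by
    rw [Real.logb, le_div_iff₀ (Real.log_pos one_lt_two)]
    nlinarith [Real.log_two_lt_d9]
  have hs1 : 400 * (d + r * Real.log d) ≤ (s : ℝ) := by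
    have : (r : ℝ) * Real.log d ≤ n * Real.logb 2 d :=
      mul_le_mul hrn' hlogb hlogd (Nat.cast_nonneg n)
    linarith
  have hrl := mul_nonneg hr0 hlogd
  have hs0 : (1 : ℝ) ≤ s := by linarith
  have hlog3 : Real.log 3 ≤ 2 := by
    have := Real.log_le_sub_one_of_pos (show (0 : ℝ) < 3 by norm_num)
    linarith
  have hlog2 := Real.log_two_lt_d9
  have hlog8 : Real.log 8 ≤ 3 := by
    rw [show (8 : ℝ) = 2 ^ 3 by norm_num, Real.log_pow]
    push_cast; linarith
  have hlog512 : Real.log 512 ≤ 7 := by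
    rw [show (512 : ℝ) = 2 ^ 9 by norm_num, Real.log_pow]
    push_cast; linarith
  have hlog13 : Real.log (13 / 16) ≤ - (3 / 16) := by
    have := Real.log_le_sub_one_of_pos (show (0 : ℝ) < 13 / 16 by norm_num)
    linarith
  have hlogs : Real.log (8 * s + 1) ≤ s / (32 * d) + 7 + Real.log d := by
    have h1 : Real.log (8 * s + 1) ≤ Real.log (s / (32 * d) * (512 * d)) := by
      refine Real.log_le_log (by positivity) ?_
      rw [div_mul_eq_mul_div, le_div_iff₀ (by positivity)]
      nlinarith
    rw [Real.log_mul (by positivity) (by positivity),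
      Real.log_mul (by norm_num) (by positivity)] at h1
    have h2 := Real.log_le_sub_one_of_pos (show (0 : ℝ) < s / (32 * d) by positivity)
    linarith
  have hfrac : (2 * r : ℝ) * (s / (32 * d)) ≤ s / 16 := by
    rw [mul_div_assoc', div_le_div_iff₀ (by positivity) (by norm_num)]
    nlinarith
  have hlast : (2 * r : ℝ) * Real.log (8 * s + 1) ≤ s / 16 + 14 * d + 2 * (r * Real.log d) := by
    have := mul_le_mul_of_nonneg_left hlogs (show (0 : ℝ) ≤ 2 * r by positivity)
    nlinarith
  have hpos : 0 < 8 * (3 ^ (15 * d) * (13 / 16 : ℝ) ^ s * (8 * s + 1) ^ (2 * r)) := by positivity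
  rw [← Real.log_nonpos_iff hpos.le, Real.log_mul (by norm_num) (by positivity),
    Real.log_mul (by positivity) (by positivity), Real.log_mul (by positivity) (by positivity),
    Real.log_pow, Real.log_pow, Real.log_pow]
  push_cast
  have h15 : 15 * (d : ℝ) * Real.log 3 ≤ 15 * d * 2 :=
    mul_le_mul_of_nonneg_left hlog3 (by positivity)
  have h13 : (s : ℝ) * Real.log (13 / 16) ≤ s * - (3 / 16) :=
    mul_le_mul_of_nonneg_left hlog13 (by positivity)
  linarith

/-- Inside a set `W` of size `8 s`, few `s`-subsets leave a large part of `W` uninferred at some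
point. -/
lemma card_filter_exists_not_infers_le {n : ℕ} {H : Finset (Fin n → ℝ)} {d s : ℕ}
    (hH : InfProp H d) {W : Finset (Fin n → ℝ)} (hWH : W ⊆ H) (hW : W.card = 8 * s) :
    (((W.powersetCard s).filter fun S => ∃ x,
      21 / 4 * (s : ℝ) ≤ (W.filter fun h => ¬ Infers S x h).card).card : ℝ) ≤
    (8 * s + 1) ^ (2 * Module.finrank ℝ (Submodule.span ℝ (H : Set (Fin n → ℝ)))) *
      (2 * 3 ^ (15 * d) * (13 / 16) ^ s) * (8 * s).choose s := by
  obtain ⟨X, hXc, hX⟩ := exists_sign_representatives W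
    (p := Submodule.span ℝ (H : Set (Fin n → ℝ))) fun v hv => Submodule.subset_span (hWH hv)
  have hsub : ((W.powersetCard s).filter fun S => ∃ x,
      21 / 4 * (s : ℝ) ≤ (W.filter fun h => ¬ Infers S x h).card) ⊆
      X.biUnion fun y => (W.powersetCard s).filter fun S =>
        21 / 4 * (s : ℝ) ≤ (W.filter fun h => ¬ Infers S y h).card := by
    intro S hS
    obtain ⟨hSW, x, hx⟩ := mem_filter.1 hS
    obtain ⟨y, hy, h1, h2⟩ := hX x
    refine mem_biUnion.2 ⟨y, hy, mem_filter.2 ⟨hSW, ?_⟩⟩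
    have e : (W.filter fun h => ¬ Infers S y h) = W.filter fun h => ¬ Infers S x h :=
      filter_congr fun h hh => not_congr
        (infers_congr (mem_powersetCard.1 hSW).1 hh h1 h2)
    rwa [e]
  have hone : ∀ y ∈ X, ((((W.powersetCard s).filter fun S =>
        21 / 4 * (s : ℝ) ≤ (W.filter fun h => ¬ Infers S y h).card).card : ℕ) : ℝ) ≤
      2 * 3 ^ (15 * d) * (13 / 16) ^ s * (8 * s).choose s := by
    intro y _
    have hN : ∀ T ⊆ W, (T.filter fun h => ¬ Infers (T.erase h) y h).card ≤ d :=
      fun T hT => hH.card_filter_not_infers_le y (hT.trans hWH)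
    convert card_filter_powersetCard_le (fun S h => ¬ Infers S y h)
      (fun S T h hST hT hS => hT (hS.mono hST)) (fun S h hN hh => hN (infers_of_mem hh))
      W s d hW fun T hT => by convert hN T hT
  have hcard := (card_le_card hsub).trans card_biUnion_le
  rw [hW] at hXc
  calc _ ≤ ((∑ y ∈ X, ((W.powersetCard s).filter fun S =>
        21 / 4 * (s : ℝ) ≤ (W.filter fun h => ¬ Infers S y h).card).card : ℕ) : ℝ) := by
        exact_mod_cast hcard
    _ ≤ X.card * (2 * 3 ^ (15 * d) * (13 / 16) ^ s * (8 * s).choose s) := by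
        rw [Nat.cast_sum, ← nsmul_eq_mul, ← sum_const]
        exact sum_le_sum hone
    _ ≤ (8 * s + 1) ^ (2 * Module.finrank ℝ (Submodule.span ℝ (H : Set (Fin n → ℝ)))) *
        (2 * 3 ^ (15 * d) * (13 / 16) ^ s * (8 * s).choose s) := by
        refine mul_le_mul_of_nonneg_right ?_ (by positivity)
        exact_mod_cast hXc
    _ = _ := by ring

/-- If `S` infers few elements of `H` at `x`, then `S` infers few elements of most of the larger
sets containing `S`. -/
lemma choose_le_two_mul_card_filter_not_infers {n : ℕ} {H S : Finset (Fin n → ℝ)} {s : ℕ}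
    (hs : 0 < s) (hS : S ∈ H.powersetCard s) {x : Fin n → ℝ}
    (hx : ((H.filter fun h => Infers S x h).card : ℝ) < (H.card : ℝ) / 8) :
    (H.card - s).choose (7 * s) ≤ 2 * (((H \ S).powersetCard (7 * s)).filter fun K => ∃ x,
      21 / 4 * (s : ℝ) ≤ ((S ∪ K).filter fun h => ¬ Infers S x h).card).card := by
  obtain ⟨hSH, hSc⟩ := mem_powersetCard.1 hS
  have hR : (H \ S).card = H.card - s := by rw [card_sdiff_of_subset hSH, hSc]
  set G := (H \ S).filter fun h => Infers S x h with hG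
  have hGc : G.card + s ≤ (H.filter fun h => Infers S x h).card := by
    rw [← hSc, ← card_union_of_disjoint
      (disjoint_of_subset_left (filter_subset _ _) sdiff_disjoint)]
    refine card_le_card (union_subset (filter_subset_filter _ sdiff_subset) fun h hh => ?_)
    exact mem_filter.2 ⟨hSH hh, infers_of_mem hh⟩
  have hx' : 8 * (H.filter fun h => Infers S x h).card < H.card := by
    rw [lt_div_iff₀ (by norm_num)] at hx
    have : 8 * ((H.filter fun h => Infers S x h).card : ℝ) < H.card := by linarith
    exact_mod_cast this
  have := choose_le_two_mul_card_filter (H \ S) G (filter_subset _ _) (by omega) (7 * s)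
    (by omega)
  rw [hR] at this
  refine this.trans (Nat.mul_le_mul_left 2 (card_le_card fun K hK => ?_))
  obtain ⟨hK, hKG⟩ := mem_filter.1 hK
  refine mem_filter.2 ⟨hK, x, ?_⟩
  obtain ⟨hKH, hKc⟩ := mem_powersetCard.1 hK
  have hsub : K \ G ⊆ (S ∪ K).filter fun h => ¬ Infers S x h := by
    intro h hh
    rw [mem_sdiff] at hh
    exact mem_filter.2 ⟨mem_union_right _ hh.1, fun hi =>
      hh.2 (mem_filter.2 ⟨hKH hh.1, hi⟩)⟩
  have h1 := card_le_card hsub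
  have h2 := card_sdiff_add_card_inter K G
  have h3 : 21 * s ≤ 4 * ((S ∪ K).filter fun h => ¬ Infers S x h).card := by omega
  have h4 : (21 : ℝ) * s ≤ 4 * (((S ∪ K).filter fun h => ¬ Infers S x h).card : ℝ) := by
    exact_mod_cast h3
  linarith

/-- random sets are universal samples: there is a universal constant `C > 0`
such that if `H ⊆ ℝ^n` has inference dimension `d ≥ 2` and `C·(d + n·log₂ d) ≤ s ≤ |H|`, then
the number of subsets `S ⊆ H` of size `s` for which some `x` has `|infer(S,x) ∩ H| < |H|/8`
is at most half of `C(|H|, s)`. -/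
theorem random_sample_good :
    ∃ C : ℝ, 0 < C ∧ ∀ (n : ℕ) (H : Finset (Fin n → ℝ)) (d s : ℕ),
      2 ≤ d → InfProp H d → C * (d + n * Real.logb 2 d) ≤ (s : ℝ) → s ≤ H.card →
      (((H.powersetCard s).filter
          (fun S => ∃ x : Fin n → ℝ,
            ((H.filter (fun h => Infers S x h)).card : ℝ) < (H.card : ℝ) / 8)).card : ℝ)
        ≤ (1 / 2) * (H.card.choose s) := by
  refine ⟨400, by norm_num, fun n H d s hd hH hs hsH => ?_⟩
  have hd' : (2 : ℝ) ≤ d := by exact_mod_cast hd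
  have hs0 : 0 < s := by
    have h1 : 0 ≤ n * Real.logb 2 d :=
      mul_nonneg (Nat.cast_nonneg n) (Real.logb_nonneg one_lt_two (by linarith))
    have : (0 : ℝ) < s := by linarith
    exact_mod_cast this
  by_cases hbig : 8 * s ≤ H.card
  · have hnum := eight_mul_pow_mul_pow_le_one hd
      ((Submodule.finrank_le (Submodule.span ℝ (H : Set (Fin n → ℝ)))).trans (by simp))
      hH.finrank_span_le hs
    refine (card_filter_powersetCard_le_of_ghost H s hbig _
      (fun W S => ∃ x, 21 / 4 * (s : ℝ) ≤ (W.filter fun h => ¬ Infers S x h).card) _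
      (fun S hS ⟨x, hx⟩ => choose_le_two_mul_card_filter_not_infers hs0 hS hx)
      (fun W hW => card_filter_exists_not_infers_le hH (mem_powersetCard.1 hW).1
        (mem_powersetCard.1 hW).2)).trans ?_
    refine mul_le_mul_of_nonneg_right ?_ (Nat.cast_nonneg _)
    linarith
  · rw [filter_eq_empty_iff.2]
    · simp
    · rintro S hS ⟨x, hx⟩
      obtain ⟨hSH, hSc⟩ := mem_powersetCard.1 hS
      have h1 : s ≤ (H.filter fun h => Infers S x h).card := by
        rw [← hSc]
        exact card_le_card fun h hh => mem_filter.2 ⟨hSH hh, infers_of_mem hh⟩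
      have h2 : (s : ℝ) ≤ (H.filter fun h => Infers S x h).card := by exact_mod_cast h1
      have h3 : (H.card : ℝ) < 8 * s := by exact_mod_cast not_le.1 hbig
      linarith

end LDT
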